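/- Pointwise convergence of CACTO values: in the CACTO iteration, for every t ∈ Fin (T+1) and every state x, the real sequence k ↦ V^{TO(π^k)}_t(x) is nonincreasing, bounded below by V*_t(x), and therefore converges to a limit V^∞_t(x) with V^∞_t(x) ≥ V*_t(x). -/

import Mathlib

/-- Value function of a policy `π`, defined by backward recursion:
`V^π_T(x) = lT x` and for `t < T`,
`V^π_t(x) = l t x (π t x) + V^π_{t+1}(f t x (π t x))`. -/
def val {S U : Type*} (T : ℕ) (f : Fin T → S → U → S) (l : Fin T → S → U → ℝ)
    (lT : S → ℝ) (π : Fin T → S → U) : Fin (T + 1) → S → ℝ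
  | t, x =>
    if h : (t : ℕ) < T then
      l ⟨t, h⟩ x (π ⟨t, h⟩ x) +
        val T f l lT π ⟨(t : ℕ) + 1, by omega⟩ (f ⟨t, h⟩ x (π ⟨t, h⟩ x))
    else lT x
  termination_by t _ => T - (t : ℕ)
  decreasing_by omega

/-- `π'` is greedy with respect to `W`. -/
def IsGreedy {S U : Type*} (T : ℕ) (f : Fin T → S → U → S) (l : Fin T → S → U → ℝ)
    (π' : Fin T → S → U) (W : Fin (T + 1) → S → ℝ) : Prop :=
  ∀ (t : Fin T) (x : S) (u : U),
    l t x (π' t x) + W t.succ (f t x (π' t x)) ≤ l t x u + W t.succ (f t x u)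

/-- The optimal value function: pointwise minimum of `val` over all (finitely many) policies. -/
noncomputable def optVal {S U : Type*} [Fintype S] [DecidableEq S] [Fintype U] [Nonempty U]
    (T : ℕ) (f : Fin T → S → U → S) (l : Fin T → S → U → ℝ) (lT : S → ℝ) :
    Fin (T + 1) → S → ℝ :=
  fun t x =>
    Finset.univ.inf' Finset.univ_nonempty (fun π : Fin T → S → U => val T f l lT π t x)

theorem val_last {S U : Type*} (T : ℕ) (f : Fin T → S → U → S) (l : Fin T → S → U → ℝ)
    (lT : S → ℝ) (π : Fin T → S → U) (x : S) : val T f l lT π (Fin.last T) x = lT x := by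
  rw [val]
  simp

theorem val_castSucc {S U : Type*} (T : ℕ) (f : Fin T → S → U → S) (l : Fin T → S → U → ℝ)
    (lT : S → ℝ) (π : Fin T → S → U) (t : Fin T) (x : S) :
    val T f l lT π t.castSucc x = l t x (π t x) + val T f l lT π t.succ (f t x (π t x)) := by
  rw [val]
  simp [Fin.succ]

/-- Policy improvement: a policy greedy with respect to the value of `π` is at least as good
as `π`. -/
theorem IsGreedy.val_le {S U : Type*} {T : ℕ} {f : Fin T → S → U → S} {l : Fin T → S → U → ℝ}
    {lT : S → ℝ} {π π' : Fin T → S → U} (h : IsGreedy T f l π' (val T f l lT π))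
    (t : Fin (T + 1)) (x : S) : val T f l lT π' t x ≤ val T f l lT π t x := by
  induction t using Fin.reverseInduction generalizing x with
  | last => simp only [val_last, le_refl]
  | cast t ih =>
    rw [val_castSucc, val_castSucc]
    exact (add_le_add_right (ih _) _).trans (h t x (π t x))

theorem optVal_le_val {S U : Type*} [Fintype S] [DecidableEq S] [Fintype U] [Nonempty U]
    (T : ℕ) (f : Fin T → S → U → S) (l : Fin T → S → U → ℝ) (lT : S → ℝ)
    (π : Fin T → S → U) (t : Fin (T + 1)) (x : S) :
    optVal T f l lT t x ≤ val T f l lT π t x :=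
  Finset.inf'_le (fun π : Fin T → S → U => val T f l lT π t x) (Finset.mem_univ π)

variable {S U : Type*} [Fintype S] [DecidableEq S] [Nonempty S] [Fintype U] [Nonempty U]
  (T : ℕ) (f : Fin T → S → U → S) (l : Fin T → S → U → ℝ) (lT : S → ℝ)

theorem cacto_pointwise_convergence
    (TO : (Fin T → S → U) → (Fin T → S → U))
    (hTO : ∀ (p : Fin T → S → U) (t : Fin (T + 1)) (x : S),
      val T f l lT (TO p) t x ≤ val T f l lT p t x)
    (π : ℕ → Fin T → S → U)
    (hgreedy : ∀ k : ℕ, IsGreedy T f l (π (k + 1)) (val T f l lT (TO (π k)))) :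
    ∀ (t : Fin (T + 1)) (x : S),
      Antitone (fun k : ℕ => val T f l lT (TO (π k)) t x) ∧
      (∀ k : ℕ, optVal T f l lT t x ≤ val T f l lT (TO (π k)) t x) ∧
      ∃ Vinf : ℝ,
        Filter.Tendsto (fun k : ℕ => val T f l lT (TO (π k)) t x)
          Filter.atTop (nhds Vinf) ∧
        optVal T f l lT t x ≤ Vinf := by
  intro t x
  have hanti : Antitone (fun k : ℕ => val T f l lT (TO (π k)) t x) :=
    antitone_nat_of_succ_le fun k => (hTO (π (k + 1)) t x).trans ((hgreedy k).val_le t x)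
  have hle (k : ℕ) : optVal T f l lT t x ≤ val T f l lT (TO (π k)) t x :=
    optVal_le_val T f l lT (TO (π k)) t x
  exact ⟨hanti, hle, _, tendsto_atTop_ciInf hanti ⟨_, Set.forall_mem_range.2 hle⟩, le_ciInf hle⟩
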